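/- arXiv:1307.2779 — 6 statements merged into one kernel-verified Lean document; each statement's English description precedes it below -/
import Mathlib

section
/- Let m ≥ 1 and let t₁, …, t_m, x₁, …, x_m ∈ [0, 2π). The following are equivalent: (1) for every ε > 0 there exists n ∈ ℤ such that [n·t_j − x_j]_{2π} ≤ ε for all j ∈ {1, …, m}; (2) for every tuple (v₁, …, v_m) ∈ ℤ^m such that [v₁t₁ + … + v_m t_m]_{2π} = 0, one has [v₁x₁ + … + v_m x_m]_{2π} = 0. -/
/-- `dist2pi x` is the distance from the real number `x` to the nearest integer
multiple of `2π`. -/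
noncomputable def dist2pi (x : ℝ) : ℝ :=
  sInf {y : ℝ | ∃ j : ℤ, y = |x - 2 * Real.pi * (j : ℝ)|}

theorem dist2pi_eq_norm (x : ℝ) :
    dist2pi x = 2 * Real.pi * ‖((x / (2 * Real.pi) : ℝ) : UnitAddCircle)‖ := by
  have hpi : 0 < 2 * Real.pi := by positivity
  have key (j : ℤ) : |x - 2 * Real.pi * j| = 2 * Real.pi * |x / (2 * Real.pi) - j| := by
    rw [← abs_of_pos hpi, ← abs_mul, abs_of_pos hpi, mul_sub, mul_div_cancel₀ _ hpi.ne']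
  rw [UnitAddCircle.norm_eq, ← key]
  refine IsLeast.csInf_eq ⟨⟨_, rfl⟩, ?_⟩
  rintro _ ⟨j, rfl⟩
  rw [key, key]
  exact mul_le_mul_of_nonneg_left (round_le _ j) hpi.le

theorem dist2pi_eq_zero_iff (x : ℝ) :
    dist2pi x = 0 ↔ ((x / (2 * Real.pi) : ℝ) : UnitAddCircle) = 0 := by
  rw [dist2pi_eq_norm, mul_eq_zero, norm_eq_zero, or_iff_right (by positivity)]

namespace UnitAddTorus

variable {d : Type*} [Fintype d]

theorem mFourier_apply_eq_toCircle (v : d → ℤ) (z : UnitAddTorus d) :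
    mFourier v z = AddCircle.toCircle (∑ i, v i • z i) := by
  have h (s : Finset d) : ∏ i ∈ s, fourier (v i) (z i) =
      (AddCircle.toCircle (∑ i ∈ s, v i • z i) : ℂ) := by
    classical
    induction s using Finset.induction_on with
    | empty => simp
    | insert a s ha ih =>
      rw [Finset.prod_insert ha, Finset.sum_insert ha, AddCircle.toCircle_add, Circle.coe_mul, ih,
        fourier_apply]
  exact h Finset.univ

theorem mFourier_apply_eq_one_iff (v : d → ℤ) (z : UnitAddTorus d) :
    mFourier v z = 1 ↔ ∑ i, v i • z i = 0 := by
  rw [mFourier_apply_eq_toCircle, Circle.coe_eq_one, ← AddCircle.toCircle_zero (T := 1),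
    (AddCircle.injective_toCircle one_ne_zero).eq_iff]

theorem mFourier_apply_add (v : d → ℤ) (y z : UnitAddTorus d) :
    mFourier v (y + z) = mFourier v y * mFourier v z := by
  simp only [mFourier_apply_eq_toCircle, Pi.add_apply, smul_add, Finset.sum_add_distrib,
    AddCircle.toCircle_add, Circle.coe_mul]

theorem mFourier_apply_nsmul (v : d → ℤ) (n : ℕ) (z : UnitAddTorus d) :
    mFourier v (n • z) = mFourier v z ^ n := by
  induction n with
  | zero => simp [mFourier]
  | succ n ih => rw [succ_nsmul, mFourier_apply_add, ih, pow_succ]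

theorem norm_mFourier_apply_le_one (v : d → ℤ) (z : UnitAddTorus d) : ‖mFourier v z‖ ≤ 1 :=
  ((mFourier v).norm_coe_le_norm z).trans_eq mFourier_norm

/-- If every character trivial at `T` is trivial at `X`, then the sums of a trigonometric polynomial
along the orbits of `X` and of `0` under translation by `T` stay at bounded distance. -/
theorem exists_norm_sum_orbit_sub_le {T X : UnitAddTorus d}
    (h : ∀ v, mFourier v T = 1 → mFourier v X = 1) {p : C(UnitAddTorus d, ℂ)}
    (hp : p ∈ Submodule.span ℂ (Set.range (mFourier (d := d)))) :
    ∃ C : ℝ, ∀ N : ℕ, ‖∑ n ∈ Finset.range N, (p (X + n • T) - p (n • T))‖ ≤ C := by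
  induction hp using Submodule.span_induction with
  | mem f hf =>
    obtain ⟨v, rfl⟩ := hf
    by_cases hT : mFourier v T = 1
    · exact ⟨0, fun N ↦ by simp [mFourier_apply_add, h v hT]⟩
    refine ⟨2 * (2 / ‖mFourier v T - 1‖), fun N ↦ ?_⟩
    have hsum : ∑ n ∈ Finset.range N, (mFourier v (X + n • T) - mFourier v (n • T)) =
        (mFourier v X - 1) * ((mFourier v (N • T) - 1) / (mFourier v T - 1)) := by
      rw [mFourier_apply_nsmul, ← geom_sum_eq hT, Finset.mul_sum]
      refine Finset.sum_congr rfl fun n _ ↦ ?_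
      rw [mFourier_apply_add, mFourier_apply_nsmul]
      ring
    have hle (z : UnitAddTorus d) : ‖mFourier v z - 1‖ ≤ 2 := by
      have := norm_sub_le (mFourier v z) 1
      have := norm_mFourier_apply_le_one v z
      norm_num at *
      linarith
    rw [hsum, norm_mul, norm_div]
    gcongr <;> apply hle
  | zero => exact ⟨0, by simp⟩
  | add f g _ _ hf hg =>
    obtain ⟨C, hC⟩ := hf
    obtain ⟨D, hD⟩ := hg
    refine ⟨C + D, fun N ↦ ?_⟩
    simp only [ContinuousMap.add_apply, add_sub_add_comm, Finset.sum_add_distrib]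
    exact norm_add_le_of_le (hC N) (hD N)
  | smul a f _ hf =>
    obtain ⟨C, hC⟩ := hf
    refine ⟨‖a‖ * C, fun N ↦ ?_⟩
    simp only [ContinuousMap.smul_apply, ← smul_sub, ← Finset.smul_sum, norm_smul]
    gcongr
    exact hC N

theorem mem_closure_zmultiples_of_mFourier {T X : UnitAddTorus d}
    (h : ∀ v, mFourier v T = 1 → mFourier v X = 1) :
    X ∈ closure (AddSubgroup.zmultiples T : Set (UnitAddTorus d)) := by
  set K : Set (UnitAddTorus d) := (AddSubgroup.zmultiples T : Set (UnitAddTorus d))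
  have hK : K.Nonempty := ⟨0, zero_mem _⟩
  by_contra hX
  set c := Metric.infDist X K
  have hc : 0 < c := (Metric.infDist_pos_iff_notMem_closure hK).mp hX
  let f : C(UnitAddTorus d, ℂ) :=
    ⟨fun z ↦ (Metric.infDist z K : ℂ),
      Complex.continuous_ofReal.comp (Metric.continuous_infDist_pt K)⟩
  have hf_mem (n : ℕ) : f (n • T) = 0 := by
    have : n • T ∈ K := nsmul_mem (AddSubgroup.mem_zmultiples T) n
    simp [f, Metric.infDist_zero_of_mem this]
  have hf_le (n : ℕ) : c ≤ (f (X + n • T)).re := by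
    refine (Metric.le_infDist hK).mpr fun {y} hy ↦ ?_
    have hy' : y - n • T ∈ K := sub_mem hy (nsmul_mem (AddSubgroup.mem_zmultiples T) n)
    calc c ≤ dist X (y - n • T) := Metric.infDist_le_dist_of_mem hy'
      _ = dist (X + n • T) y := by rw [dist_eq_norm, dist_eq_norm]; congr 1; abel
  have hf_span : f ∈ closure (Submodule.span ℂ (Set.range (mFourier (d := d))) : Set _) := by
    rw [← Submodule.topologicalClosure_coe, span_mFourier_closure_eq_top]
    trivial
  obtain ⟨p, hp, hfp⟩ := Metric.mem_closure_iff.mp hf_span (c / 3) (by positivity)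
  obtain ⟨C, hC⟩ := exists_norm_sum_orbit_sub_le h hp
  have hclose (z : UnitAddTorus d) : ‖f z - p z‖ ≤ c / 3 := by
    rw [← dist_eq_norm]
    exact (ContinuousMap.dist_apply_le_dist z).trans hfp.le
  have hterm (n : ℕ) : c / 3 ≤ (p (X + n • T) - p (n • T)).re := by
    have h₁ := (Complex.re_le_norm _).trans (hclose (X + n • T))
    have h₂ := (Complex.re_le_norm _).trans ((norm_sub_rev _ _).trans_le (hclose (n • T)))
    have h₃ := hf_le n
    rw [hf_mem] at h₂
    simp only [Complex.sub_re, Complex.zero_re] at h₁ h₂ ⊢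
    linarith
  obtain ⟨N, hN⟩ := exists_nat_gt (C / (c / 3))
  rw [div_lt_iff₀ (by positivity)] at hN
  refine absurd ((Complex.re_le_norm _).trans (hC N)) (not_le.mpr (hN.trans_le ?_))
  rw [Complex.re_sum]
  simpa using Finset.card_nsmul_le_sum (Finset.range N) _ _ fun n _ ↦ hterm n

/-- **Kronecker's theorem** on the torus: `X` is a limit of multiples of `T` if and only if `X`
satisfies every integral linear relation satisfied by `T`. -/
theorem mem_closure_zmultiples_iff {T X : UnitAddTorus d} :
    X ∈ closure (AddSubgroup.zmultiples T : Set (UnitAddTorus d)) ↔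
      ∀ v : d → ℤ, ∑ i, v i • T i = 0 → ∑ i, v i • X i = 0 := by
  refine ⟨fun hX v hv ↦ ?_, fun h ↦ mem_closure_zmultiples_of_mFourier fun v ↦ ?_⟩
  · have hclosed : IsClosed {z : UnitAddTorus d | ∑ i, v i • z i = 0} :=
      isClosed_eq (by fun_prop) continuous_const
    refine closure_minimal ?_ hclosed hX
    rintro _ ⟨n, rfl⟩
    simp [smul_comm _ n, ← Finset.smul_sum, hv]
  · simpa only [mFourier_apply_eq_one_iff] using h v

end UnitAddTorus

theorem kronecker_simultaneous_approximation
    {m : ℕ} (hm : 1 ≤ m) (t x : Fin m → ℝ)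
    (ht : ∀ j, t j ∈ Set.Ico (0 : ℝ) (2 * Real.pi))
    (hx : ∀ j, x j ∈ Set.Ico (0 : ℝ) (2 * Real.pi)) :
    (∀ ε : ℝ, 0 < ε → ∃ n : ℤ, ∀ j, dist2pi ((n : ℝ) * t j - x j) ≤ ε) ↔
    (∀ v : Fin m → ℤ, dist2pi (∑ j, (v j : ℝ) * t j) = 0 →
      dist2pi (∑ j, (v j : ℝ) * x j) = 0) := by
  let T : UnitAddTorus (Fin m) := fun j ↦ ((t j / (2 * Real.pi) : ℝ) : UnitAddCircle)
  let X : UnitAddTorus (Fin m) := fun j ↦ ((x j / (2 * Real.pi) : ℝ) : UnitAddCircle)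
  have hpi : 0 < 2 * Real.pi := by positivity
  have hrel (v : Fin m → ℤ) (y : Fin m → ℝ) : dist2pi (∑ j, (v j : ℝ) * y j) = 0 ↔
      ∑ j, v j • ((y j / (2 * Real.pi) : ℝ) : UnitAddCircle) = 0 := by
    rw [dist2pi_eq_zero_iff, Finset.sum_div]
    simp_rw [mul_div_assoc, ← zsmul_eq_mul]
    simp only [← AddCircle.coe_zsmul, ← QuotientAddGroup.mk_sum]
  have hdist (n : ℤ) (j : Fin m) :
      dist2pi ((n : ℝ) * t j - x j) = 2 * Real.pi * ‖(n • T - X) j‖ := by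
    rw [dist2pi_eq_norm, sub_div, mul_div_assoc, ← zsmul_eq_mul, AddCircle.coe_sub,
      AddCircle.coe_zsmul]
    rfl
  simp only [hrel]
  rw [← UnitAddTorus.mem_closure_zmultiples_iff (T := T) (X := X), Metric.mem_closure_iff]
  constructor
  · intro h ε hε
    obtain ⟨n, hn⟩ := h (2 * Real.pi * (ε / 2)) (by positivity)
    refine ⟨n • T, ⟨n, rfl⟩, ?_⟩
    rw [dist_comm, dist_eq_norm]
    refine ((pi_norm_le_iff_of_nonneg (by positivity)).mpr fun j ↦ ?_).trans_lt (half_lt_self hε)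
    exact le_of_mul_le_mul_left ((hdist n j).symm.trans_le (hn j)) hpi
  · intro h ε hε
    obtain ⟨_, ⟨n, rfl⟩, hn⟩ := h (ε / (2 * Real.pi)) (by positivity)
    refine ⟨n, fun j ↦ ?_⟩
    rw [dist_comm, dist_eq_norm, lt_div_iff₀' hpi] at hn
    rw [hdist]
    exact (mul_le_mul_of_nonneg_left (norm_le_pi_norm _ j) hpi.le).trans hn.le
end

section
/- Let m ≥ 1 and let t₁, …, t_m, x₁, …, x_m ∈ [0, 2π). If for every tuple (v₁, …, v_m) ∈ ℤ^m such that [v₁t₁ + … + v_m t_m]_{2π} = 0 one has [v₁x₁ + … + v_m x_m]_{2π} = 0, then for every ε > 0 there exists a natural number n ∈ ℕ such that [n·t_j − x_j]_{2π} ≤ ε for all j ∈ {1, …, m}. -/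
open Filter Topology in
/-- The Cesàro means of the powers of a unimodular number `u` tend to `1` if `u = 1`
and to `0` otherwise. -/
theorem tendsto_cesaro_pow_of_norm_eq_one {u : ℂ} (hu : ‖u‖ = 1) :
    Tendsto (fun N : ℕ => (∑ n ∈ Finset.range N, u ^ n) / (N : ℂ)) atTop
      (𝓝 (if u = 1 then 1 else 0)) := by
  split_ifs with h
  · subst h
    refine tendsto_const_nhds.congr' ?_
    filter_upwards [eventually_ne_atTop 0] with N hN
    simp [hN]
  · rw [tendsto_zero_iff_norm_tendsto_zero]
    refine squeeze_zero (fun _ => norm_nonneg _) (fun N => ?_)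
      (tendsto_const_div_atTop_nhds_zero_nat (2 / ‖u - 1‖))
    rw [geom_sum_eq h, norm_div, norm_div, Complex.norm_natCast]
    gcongr
    calc ‖u ^ N - 1‖ ≤ ‖u ^ N‖ + ‖(1 : ℂ)‖ := norm_sub_le _ _
      _ = 2 := by rw [norm_pow, hu]; norm_num

theorem norm_exp_I_mul_sub_one_le_dist2pi (θ : ℝ) :
    ‖Complex.exp (Complex.I * θ) - 1‖ ≤ dist2pi θ := by
  refine le_csInf ⟨_, 0, rfl⟩ ?_
  rintro _ ⟨j, rfl⟩
  have h := Real.norm_exp_I_mul_ofReal_sub_one_le (x := θ - 2 * Real.pi * j)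
  have e : Complex.exp (Complex.I * ((θ - 2 * Real.pi * j : ℝ) : ℂ))
      = Complex.exp (Complex.I * θ) := by
    rw [Complex.exp_eq_exp_iff_exists_int]
    exact ⟨-j, by push_cast; ring⟩
  rwa [e, Real.norm_eq_abs] at h

theorem dist2pi_le_abs_sub (θ : ℝ) (j : ℤ) : dist2pi θ ≤ |θ - 2 * Real.pi * j| :=
  csInf_le ⟨0, by rintro _ ⟨i, rfl⟩; positivity⟩ ⟨j, rfl⟩

theorem dist2pi_eq_zero_iff_s7 {θ : ℝ} : dist2pi θ = 0 ↔ Complex.exp (Complex.I * θ) = 1 := by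
  constructor
  · intro h
    have := norm_exp_I_mul_sub_one_le_dist2pi θ
    rw [h] at this
    exact sub_eq_zero.1 (norm_le_zero_iff.1 this)
  · intro h
    refine le_antisymm ?_ ((norm_nonneg _).trans (norm_exp_I_mul_sub_one_le_dist2pi θ))
    obtain ⟨j, hj⟩ := Complex.exp_eq_one_iff.1 h
    have hj' : (θ : ℂ) = ((2 * Real.pi * j : ℝ) : ℂ) := by
      apply mul_left_cancel₀ Complex.I_ne_zero
      rw [hj]; push_cast; ring
    have := dist2pi_le_abs_sub θ j
    rwa [sub_eq_zero.2 (Complex.ofReal_injective hj'), abs_zero] at this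

theorem lt_pi_and_cos_lt_of_lt_dist2pi {θ ε : ℝ} (hε : 0 < ε) (h : ε < dist2pi θ) :
    ε < Real.pi ∧ Real.cos θ < Real.cos ε := by
  set j := toIocDiv Real.two_pi_pos (-Real.pi) θ
  have hmem := sub_toIocDiv_zsmul_mem_Ioc Real.two_pi_pos (-Real.pi) θ
  have hj : θ - j • (2 * Real.pi) = θ - 2 * Real.pi * j := by simp [mul_comm]
  change θ - j • (2 * Real.pi) ∈ _ at hmem
  rw [hj] at hmem
  have hπ : |θ - 2 * Real.pi * j| ≤ Real.pi :=
    abs_le.2 ⟨hmem.1.le, by linarith [hmem.2]⟩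
  have hlt := h.trans_le (dist2pi_le_abs_sub θ j)
  refine ⟨hlt.trans_le hπ, ?_⟩
  have := Real.cos_lt_cos_of_nonneg_of_le_pi hε.le hπ hlt
  rwa [Real.cos_abs, mul_comm, Real.cos_sub_int_mul_two_pi] at this

theorem normSq_exp_I_mul_add_one (θ : ℝ) :
    ‖Complex.exp (Complex.I * θ) + 1‖ ^ 2 = 2 + 2 * Real.cos θ := by
  rw [mul_comm, Complex.exp_mul_I, ← Complex.normSq_eq_norm_sq, Complex.normSq_apply]
  simp only [Complex.add_re, Complex.add_im, Complex.mul_re, Complex.mul_im, Complex.cos_ofReal_re,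
    Complex.cos_ofReal_im, Complex.sin_ofReal_re, Complex.sin_ofReal_im, Complex.I_re,
    Complex.I_im, Complex.one_re, Complex.one_im]
  nlinarith [Real.sin_sq_add_cos_sq θ]

/-- The trigonometric polynomial `(2 + 2 cos θ) ^ k`, written as a complex exponential sum. -/
noncomputable def cosKernel (k : ℕ) (θ : ℝ) : ℂ :=
  ∑ l ∈ Finset.range (2 * k + 1),
    ((2 * k).choose l : ℂ) * Complex.exp (Complex.I * (((l : ℝ) - k) * θ : ℝ))

theorem norm_cosKernel (k : ℕ) (θ : ℝ) : ‖cosKernel k θ‖ = (2 + 2 * Real.cos θ) ^ k := by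
  have h : cosKernel k θ = Complex.exp (Complex.I * (-(k * θ) : ℝ)) *
      (Complex.exp (Complex.I * θ) + 1) ^ (2 * k) := by
    rw [add_pow, Finset.mul_sum]
    refine Finset.sum_congr rfl fun l _ => ?_
    rw [one_pow, mul_one, ← mul_assoc, ← Complex.exp_nat_mul, ← Complex.exp_add, mul_comm]
    congr 2
    push_cast; ring
  rw [h, norm_mul, mul_comm Complex.I, Complex.norm_exp_ofReal_mul_I, one_mul, norm_pow, pow_mul,
    normSq_exp_I_mul_add_one]

theorem prod_cosKernel {ι : Type*} [Fintype ι] [DecidableEq ι] (k n : ℕ) (t x : ι → ℝ) :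
    ∏ j, cosKernel k (n * t j - x j) =
      ∑ l ∈ Fintype.piFinset fun _ : ι => Finset.range (2 * k + 1),
        (∏ j, ((2 * k).choose (l j) : ℂ)) *
          (Complex.exp (Complex.I * (∑ j, (((l j : ℤ) - k : ℤ) : ℝ) * t j : ℝ)) ^ n *
            (Complex.exp (Complex.I * (∑ j, (((l j : ℤ) - k : ℤ) : ℝ) * x j : ℝ)))⁻¹) := by
  simp only [cosKernel]
  rw [Finset.prod_univ_sum]
  refine Finset.sum_congr rfl fun l _ => ?_
  rw [Finset.prod_mul_distrib, ← Complex.exp_sum, ← Complex.exp_nat_mul, ← Complex.exp_neg,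
    ← Complex.exp_add]
  congr 2
  push_cast
  simp only [Finset.mul_sum, ← Finset.sum_neg_distrib, ← Finset.sum_add_distrib]
  exact Finset.sum_congr rfl fun j _ => by ring

open Filter Topology in
/-- If the products of kernels along the orbit are bounded by `B`, then so is the constant
coefficient of the product kernel. -/
theorem centralBinom_pow_card_le_of_norm_prod_cosKernel_le {ι : Type*} [Fintype ι]
    (t x : ι → ℝ)
    (h : ∀ v : ι → ℤ, dist2pi (∑ j, (v j : ℝ) * t j) = 0 →
      dist2pi (∑ j, (v j : ℝ) * x j) = 0) (k : ℕ) {B : ℝ}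
    (hB : ∀ n : ℕ, ‖∏ j, cosKernel k (n * t j - x j)‖ ≤ B) :
    (k.centralBinom : ℝ) ^ Fintype.card ι ≤ B := by
  classical
  set S := Fintype.piFinset fun _ : ι => Finset.range (2 * k + 1)
  set u : (ι → ℕ) → ℂ := fun l =>
    Complex.exp (Complex.I * (∑ j, (((l j : ℤ) - k : ℤ) : ℝ) * t j : ℝ))
  set w : (ι → ℕ) → ℂ := fun l =>
    (Complex.exp (Complex.I * (∑ j, (((l j : ℤ) - k : ℤ) : ℝ) * x j : ℝ)))⁻¹
  have hu : ∀ l, ‖u l‖ = 1 := fun l => by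
    simp only [u]
    rw [mul_comm, Complex.norm_exp_ofReal_mul_I]
  have huw : ∀ l, u l = 1 → w l = 1 := fun l hl => by
    simp only [w]
    rw [dist2pi_eq_zero_iff_s7.1 (h (fun j => (l j : ℤ) - k) (dist2pi_eq_zero_iff_s7.2 hl)), inv_one]
  have hlim : Tendsto (fun N : ℕ => (∑ n ∈ Finset.range N,
      ∏ j, cosKernel k (n * t j - x j)) / (N : ℂ)) atTop
      (𝓝 ((∑ l ∈ S, (∏ j, ((2 * k).choose (l j) : ℝ)) * (if u l = 1 then 1 else 0) : ℝ) : ℂ)) := by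
    have h1 : Tendsto (fun N : ℕ => ∑ l ∈ S, ((∏ j, ((2 * k).choose (l j) : ℂ)) * w l) *
        ((∑ n ∈ Finset.range N, u l ^ n) / (N : ℂ))) atTop
        (𝓝 (∑ l ∈ S, ((∏ j, ((2 * k).choose (l j) : ℂ)) * w l) *
          (if u l = 1 then 1 else 0))) :=
      tendsto_finsetSum _ fun l _ =>
        (tendsto_cesaro_pow_of_norm_eq_one (hu l)).const_mul _
    convert h1 using 1
    · funext N
      simp only [prod_cosKernel]
      rw [Finset.sum_comm, Finset.sum_div]
      refine Finset.sum_congr rfl fun l _ => ?_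
      rw [← mul_div_assoc, Finset.mul_sum]
      congr 1
      exact Finset.sum_congr rfl fun n _ => by simp only [u, w]; ring
    · congr 1
      push_cast
      refine Finset.sum_congr rfl fun l _ => ?_
      split_ifs with hl
      · simp [huw l hl]
      · simp
  have hB0 : 0 ≤ B := (norm_nonneg _).trans (hB 0)
  have hle := le_of_tendsto hlim.norm (b := B) <| Eventually.of_forall fun N => by
    rw [norm_div, Complex.norm_natCast]
    refine div_le_of_le_mul₀ (Nat.cast_nonneg N) hB0 ?_
    refine (norm_sum_le_of_le _ fun n _ => hB n).trans_eq ?_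
    simp [mul_comm]
  rw [Complex.norm_real] at hle
  refine le_trans ?_ ((le_abs_self _).trans hle)
  have hmem : (fun _ => k) ∈ S := by
    simp only [S, Fintype.mem_piFinset, Finset.mem_range]
    intro; omega
  refine le_trans (le_of_eq ?_) (Finset.single_le_sum (fun l _ => ?_) hmem)
  · simp [u, Nat.centralBinom]
  · split_ifs <;> positivity

open Filter Topology in
theorem exists_two_mul_add_one_pow_mul_pow_lt_one (m : ℕ) {r : ℝ} (h0 : 0 ≤ r) (h1 : r < 1) :
    ∃ k : ℕ, (2 * k + 1 : ℝ) ^ m * r ^ k < 1 := by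
  have h := (tendsto_pow_const_mul_const_pow_of_lt_one m h0 h1).const_mul ((3 : ℝ) ^ m)
  rw [mul_zero] at h
  obtain ⟨k, hk, hk1⟩ := ((h.eventually_lt_const one_pos).and (eventually_ge_atTop 1)).exists
  refine ⟨k, lt_of_le_of_lt ?_ hk⟩
  have hk1' : (1 : ℝ) ≤ k := by exact_mod_cast hk1
  rw [← mul_assoc, ← mul_pow]
  gcongr
  linarith

theorem kronecker_simultaneous_approximation_nat
    {m : ℕ} (hm : 1 ≤ m) (t x : Fin m → ℝ)
    (ht : ∀ j, t j ∈ Set.Ico (0 : ℝ) (2 * Real.pi))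
    (hx : ∀ j, x j ∈ Set.Ico (0 : ℝ) (2 * Real.pi))
    (h : ∀ v : Fin m → ℤ, dist2pi (∑ j, (v j : ℝ) * t j) = 0 →
      dist2pi (∑ j, (v j : ℝ) * x j) = 0) :
    ∀ ε : ℝ, 0 < ε → ∃ n : ℕ, ∀ j, dist2pi ((n : ℝ) * t j - x j) ≤ ε := by
  intro ε hε
  by_contra! hcon
  obtain ⟨i, hi⟩ := hcon 0
  have hεπ := (lt_pi_and_cos_lt_of_lt_dist2pi hε hi).1
  have hcos : Real.cos ε < 1 := by
    simpa using Real.cos_lt_cos_of_nonneg_of_le_pi le_rfl hεπ.le hε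
  set r : ℝ := (1 + Real.cos ε) / 2 with hr
  have hr0 : 0 ≤ r := by linarith [Real.neg_one_le_cos ε]
  obtain ⟨k, hk⟩ := exists_two_mul_add_one_pow_mul_pow_lt_one m hr0 (by linarith)
  have hB : ∀ n : ℕ, ‖∏ j, cosKernel k (n * t j - x j)‖ ≤ ((4 : ℝ) ^ k) ^ m * r ^ k := by
    intro n
    obtain ⟨j, hj⟩ := hcon n
    have hcj := (lt_pi_and_cos_lt_of_lt_dist2pi hε hj).2
    have hnn : ∀ θ : ℝ, 0 ≤ 2 + 2 * Real.cos θ := fun θ => by linarith [Real.neg_one_le_cos θ]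
    rw [norm_prod, ← Finset.mul_prod_erase _ _ (Finset.mem_univ j)]
    calc _ ≤ (4 * r) ^ k * ∏ _i ∈ Finset.univ.erase j, (4 : ℝ) ^ k := by
          gcongr with i
          · rw [norm_cosKernel]
            exact pow_le_pow_left₀ (hnn _) (by linarith) k
          · rw [norm_cosKernel]
            exact pow_le_pow_left₀ (hnn _) (by linarith [Real.cos_le_one (n * t i - x i)]) k
      _ = ((4 : ℝ) ^ k) ^ m * r ^ k := by
          rw [Finset.prod_const, Finset.card_erase_of_mem (Finset.mem_univ j), Finset.card_univ,
            Fintype.card_fin, mul_pow, mul_right_comm, mul_pow_sub_one (by omega)]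
  have hle := centralBinom_pow_card_le_of_norm_prod_cosKernel_le t x h k hB
  rw [Fintype.card_fin] at hle
  have h4 : (4 : ℝ) ^ k ≤ (2 * k + 1) * k.centralBinom := by
    exact_mod_cast Nat.four_pow_le_two_mul_add_one_mul_central_binom k
  have hpos : (0 : ℝ) < (k.centralBinom : ℝ) ^ m := by
    have := k.centralBinom_pos
    positivity
  have : (k.centralBinom : ℝ) ^ m < (k.centralBinom : ℝ) ^ m := calc
    _ ≤ ((4 : ℝ) ^ k) ^ m * r ^ k := hle
    _ ≤ ((2 * k + 1) * k.centralBinom : ℝ) ^ m * r ^ k := by gcongr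
    _ = (k.centralBinom : ℝ) ^ m * ((2 * k + 1 : ℝ) ^ m * r ^ k) := by rw [mul_pow]; ring
    _ < (k.centralBinom : ℝ) ^ m * 1 := by gcongr
    _ = _ := mul_one _
  exact lt_irrefl _ this
end

section
/- Let p and q be rational numbers with p² + q² = 1, p ≠ 0 and q ≠ 0. Then the real number t = arg(p + qi)/(2π) is transcendental over ℚ. -/
/-- An entire function vanishing to order at least `r` at `a` is divisible by `(z - a) ^ r`
among entire functions. -/
theorem Differentiable.exists_eq_sub_pow_mul {f : ℂ → ℂ} (hf : Differentiable ℂ f) {a : ℂ} (r : ℕ)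
    (h : (r : ℕ∞) ≤ analyticOrderAt f a) :
    ∃ g : ℂ → ℂ, Differentiable ℂ g ∧ ∀ z, f z = (z - a) ^ r * g z := by
  induction r with
  | zero => exact ⟨f, hf, by simp⟩
  | succ r ih =>
    obtain ⟨g, hg, hfg⟩ := ih (le_trans (by simp) h)
    have hord : analyticOrderAt f a = r + analyticOrderAt g a := by
      rw [show f = (fun z ↦ z - a) ^ r * g from funext hfg,
        analyticOrderAt_mul (by fun_prop) (hg.analyticAt a), analyticOrderAt_pow (by fun_prop),
        analyticOrderAt_id_sub_const_self]
      simp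
    have hga : g a = 0 := by
      rw [← (hg.analyticAt a).analyticOrderAt_ne_zero]
      intro h0
      rw [hord, h0, add_zero] at h
      exact absurd (Nat.cast_le.mp h) (by lia)
    refine ⟨dslope g a, ?_, fun z ↦ ?_⟩
    · rw [← differentiableOn_univ] at hg ⊢
      exact (Complex.differentiableOn_dslope Filter.univ_mem).mpr hg
    · rw [hfg, pow_succ, mul_assoc, ← smul_eq_mul (z - a), sub_smul_dslope_of_zero hga]

theorem Differentiable.exists_eq_prod_sub_pow_mul {f : ℂ → ℂ} (hf : Differentiable ℂ f)
    (S : Finset ℂ) (r : ℕ) (h : ∀ a ∈ S, (r : ℕ∞) ≤ analyticOrderAt f a) :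
    ∃ g : ℂ → ℂ, Differentiable ℂ g ∧ ∀ z, f z = (∏ a ∈ S, (z - a)) ^ r * g z := by
  classical
  induction S using Finset.induction_on with
  | empty => exact ⟨f, hf, by simp⟩
  | insert a S ha ih =>
    obtain ⟨g, hg, hfg⟩ := ih fun b hb ↦ h b (Finset.mem_insert_of_mem hb)
    have hP : analyticOrderAt (fun z ↦ (∏ b ∈ S, (z - b)) ^ r) a = 0 := by
      rw [AnalyticAt.analyticOrderAt_eq_zero (by fun_prop)]
      exact pow_ne_zero _ (Finset.prod_ne_zero_iff.mpr fun b hb ↦ sub_ne_zero.mpr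
        (ne_of_mem_of_not_mem hb ha).symm)
    have hord : analyticOrderAt f a = analyticOrderAt g a := by
      rw [show f = (fun z ↦ (∏ b ∈ S, (z - b)) ^ r) * g from funext hfg,
        analyticOrderAt_mul (by fun_prop) (hg.analyticAt a), hP, zero_add]
    obtain ⟨k, hk, hgk⟩ := hg.exists_eq_sub_pow_mul r (hord ▸ h a (Finset.mem_insert_self a S))
    refine ⟨k, hk, fun z ↦ ?_⟩
    rw [hfg, hgk, Finset.prod_insert ha, mul_pow]
    ring

/-- The Schwarz-type estimate for an entire function with zeros of high order at
`0, 1, …, m - 1`. -/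
theorem norm_iteratedDeriv_le_of_iteratedDeriv_natCast_eq_zero {f : ℂ → ℂ}
    (hf : Differentiable ℂ f) {m r : ℕ}
    (h0 : ∀ k < m, ∀ i < r, iteratedDeriv i f (k : ℂ) = 0) {R B : ℝ} (hR : 2 * m ≤ R)
    (hB : ∀ z : ℂ, ‖z‖ = R → ‖f z‖ ≤ B) {k : ℕ} (hk : k < m) :
    ‖iteratedDeriv r f (k : ℂ)‖ ≤ r.factorial * (B * (4 * m / R) ^ (m * r)) := by
  have hm : (1 : ℝ) ≤ m := by exact_mod_cast (by lia : 1 ≤ m)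
  have hR0 : 0 < R := by linarith
  set S : Finset ℂ := (Finset.range m).image (fun k : ℕ ↦ (k : ℂ)) with hS
  have hcard : S.card = m := by
    rw [hS, Finset.card_image_of_injective _ Nat.cast_injective, Finset.card_range]
  have hSnorm : ∀ a ∈ S, ‖a‖ ≤ m - 1 := by
    simp only [hS, Finset.mem_image, Finset.mem_range]
    rintro _ ⟨j, hj, rfl⟩
    rw [Complex.norm_natCast, le_sub_iff_add_le]
    exact_mod_cast hj
  obtain ⟨g, hg, hfg⟩ := hf.exists_eq_prod_sub_pow_mul S r (by
    simp only [hS, Finset.mem_image, Finset.mem_range]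
    rintro _ ⟨j, hj, rfl⟩
    exact (natCast_le_analyticOrderAt_iff_iteratedDeriv_eq_zero (hf.analyticAt _)).mpr (h0 j hj))
  have hgB : ∀ z ∈ Metric.closedBall (0 : ℂ) R, ‖g z‖ ≤ B / (R / 2) ^ (m * r) := by
    intro z hz
    rw [← closure_ball (0 : ℂ) hR0.ne'] at hz
    refine Complex.norm_le_of_forall_mem_frontier_norm_le Metric.isBounded_ball hg.diffContOnCl
      (fun w hw ↦ ?_) hz
    rw [frontier_ball (0 : ℂ) hR0.ne', mem_sphere_zero_iff_norm] at hw
    rw [le_div_iff₀ (by positivity)]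
    refine le_trans ?_ (hB w hw)
    rw [hfg, norm_mul, mul_comm, norm_pow, norm_prod, pow_mul]
    gcongr
    calc (R / 2) ^ m = ∏ a ∈ S, R / 2 := by rw [Finset.prod_const, hcard]
      _ ≤ ∏ a ∈ S, ‖w - a‖ := by
        gcongr with a ha
        have := norm_sub_norm_le w a
        have := hSnorm a ha
        linarith
  have hfB : ∀ z ∈ Metric.sphere (k : ℂ) 1, ‖f z‖ ≤ B * (4 * m / R) ^ (m * r) := by
    intro z hz
    rw [mem_sphere_iff_norm] at hz
    have hzm : ‖z‖ ≤ m := by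
      have h1 := norm_sub_norm_le z (k : ℂ)
      rw [Complex.norm_natCast, hz] at h1
      have : (k : ℝ) + 1 ≤ m := by exact_mod_cast hk
      linarith
    have hgz := hgB z (by rw [mem_closedBall_zero_iff]; linarith)
    calc ‖f z‖ = (∏ a ∈ S, ‖z - a‖) ^ r * ‖g z‖ := by
          rw [hfg, norm_mul, norm_pow, norm_prod]
      _ ≤ (∏ a ∈ S, (2 * m : ℝ)) ^ r * (B / (R / 2) ^ (m * r)) := by
        gcongr with a ha
        have := norm_sub_le z a
        have := hSnorm a ha
        linarith
      _ = B * (4 * m / R) ^ (m * r) := by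
        rw [Finset.prod_const, hcard, ← pow_mul, show (4 * m / R : ℝ) = 2 * m / (R / 2) by
          field_simp; ring, div_pow _ (R / 2)]
        ring
  simpa using Complex.norm_iteratedDeriv_le_of_forall_mem_sphere_norm_le r one_pos
    hf.diffContOnCl hfB

theorem iteratedDeriv_sum_const_mul_cexp {ι : Type*} [Fintype ι] (c μ : ι → ℂ) (s : ℕ) (z : ℂ) :
    iteratedDeriv s (fun z ↦ ∑ u, c u * Complex.exp (μ u * z)) z =
      ∑ u, c u * (μ u ^ s * Complex.exp (μ u * z)) := by
  rw [iteratedDeriv_fun_sum fun u _ ↦ by fun_prop]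
  refine Finset.sum_congr rfl fun u _ ↦ ?_
  rw [iteratedDeriv_const_mul_field, iteratedDeriv_cexp_const_mul]

/-- A power-sum form of the nonvanishing of the Vandermonde determinant. -/
theorem exists_sum_mul_pow_ne_zero {R ι : Type*} [CommRing R] [IsDomain R] [Fintype ι]
    {c v : ι → R} (hv : Function.Injective v) (hc : c ≠ 0) : ∃ s : ℕ, ∑ u, c u * v u ^ s ≠ 0 := by
  by_contra! h
  let e := Fintype.equivFin ι
  have h0 : c ∘ e.symm = 0 := Matrix.eq_zero_of_forall_pow_sum_mul_pow_eq_zero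
    (f := v ∘ e.symm) (hv.comp e.symm.injective) fun i ↦ by
      rw [← h i]
      exact e.symm.sum_comp fun u ↦ c u * v u ^ (i : ℕ)
  refine hc (funext fun u ↦ ?_)
  simpa using congrFun h0 (e u)

namespace NumberField

variable (K : Type*) [Field K] [NumberField K]

/-- Siegel's lemma over a number field, with twice as many unknowns as equations. -/
theorem exists_siegel_const : ∃ C : ℝ, ∀ (ι κ : Type) [Fintype ι] [Fintype κ] [Nonempty κ]
    (a : Matrix κ ι (𝓞 K)) (A : ℝ), a ≠ 0 → Fintype.card ι = 2 * Fintype.card κ →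
    (∀ k u, house (a k u : K) ≤ A) →
    ∃ c : ι → 𝓞 K, c ≠ 0 ∧ a.mulVec c = 0 ∧
      ∀ u, house (c u : K) ≤ C * (C * Fintype.card ι * A) := by
  classical
  refine ⟨?_, fun ι κ _ _ _ a A ha hcard hA ↦ ?_⟩
  rotate_left
  · have hκ : 0 < Fintype.card κ := Fintype.card_pos
    obtain ⟨c, hc, hac, hcA⟩ := house.exists_ne_zero_int_vec_house_le K a ha hκ
      (by lia : Fintype.card κ < Fintype.card ι) rfl hA rfl
    refine ⟨c, hc, hac, fun u ↦ (hcA u).trans_eq ?_⟩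
    have : (Fintype.card κ : ℝ) / (Fintype.card ι - Fintype.card κ) = 1 := by
      rw [hcard]
      push_cast
      field_simp
      ring
    rw [this, Real.rpow_one]

variable {K}

theorem one_le_norm_mul_house_pow {ρ : 𝓞 K} (hρ : ρ ≠ 0) (σ : K →+* ℂ) :
    1 ≤ ‖σ ρ‖ * house (ρ : K) ^ (Module.finrank ℚ K - 1) := by
  refine le_trans ?_ (norm_norm_le_norm_mul_house_pow (ρ : K) σ)
  rw [← Algebra.coe_norm_int, ← Rat.norm_cast_real, Rat.cast_intCast, Real.norm_eq_abs]
  exact_mod_cast Int.one_le_abs (Algebra.norm_ne_zero_iff.mpr hρ)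

end NumberField

namespace NumberField

variable {K : Type*} [Field K] [NumberField K]

theorem house_natCast (a : ℕ) : house (a : K) = a := by
  exact_mod_cast house_intCast (K := K) a

theorem house_sum_mul_pow_mul_pow_le {ι : Type*} [Fintype ι] {c lam χ : ι → 𝓞 K} {H X C : ℝ}
    (hX : 1 ≤ X) (hc : ∀ u, house (c u : K) ≤ C) (hlam : ∀ u, house (lam u : K) ≤ H)
    (hχ : ∀ u, house (χ u : K) ≤ X) (r : ℕ) {k m : ℕ} (hk : k ≤ m) :
    house ((∑ u, c u * (lam u ^ r * χ u ^ k) : 𝓞 K) : K) ≤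
      Fintype.card ι * C * (H ^ r * X ^ m) := by
  push_cast
  refine (house_sum_le_sum_house _ _).trans ?_
  rw [mul_assoc, ← nsmul_eq_mul, ← Finset.card_univ]
  refine Finset.sum_le_card_nsmul _ _ _ fun u _ ↦ ?_
  have hC := (house_nonneg (c u : K)).trans (hc u)
  have hH := (house_nonneg (lam u : K)).trans (hlam u)
  refine (house_mul_le _ _).trans (mul_le_mul (hc u) ?_ (house_nonneg _) hC)
  refine (house_mul_le _ _).trans (mul_le_mul ?_ ?_ (house_nonneg _) (by positivity))
  · exact (house_pow_le _ _).trans (pow_le_pow_left₀ (house_nonneg _) (hlam u) r)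
  · exact (house_pow_le _ _).trans ((pow_le_pow_left₀ (house_nonneg _) (hχ u) k).trans
      (pow_le_pow_right₀ hX hk))

variable (K) in
/-- Siegel's lemma applied to the vanishing conditions at `0, …, m - 1` to order `n`. -/
theorem exists_siegel_const_sum_mul_pow_mul_pow : ∃ C : ℝ, ∀ (ι : Type) [Fintype ι]
    (lam χ : ι → 𝓞 K) (m n : ℕ) (H X : ℝ), 0 < m → 0 < n → 1 ≤ H → 1 ≤ X →
    Fintype.card ι = 2 * (m * n) → (∀ u, house (lam u : K) ≤ H) → (∀ u, house (χ u : K) ≤ X) →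
    ∃ c : ι → 𝓞 K, c ≠ 0 ∧ (∀ k < m, ∀ s < n, ∑ u, c u * (lam u ^ s * χ u ^ k) = 0) ∧
      ∀ u, house (c u : K) ≤ C * (C * Fintype.card ι * (H ^ n * X ^ m)) := by
  obtain ⟨C, hC⟩ := exists_siegel_const K
  refine ⟨C, fun ι _ lam χ m n H X hm hn hH hX hcard hlam hχ ↦ ?_⟩
  have : NeZero m := ⟨hm.ne'⟩
  have : NeZero n := ⟨hn.ne'⟩
  obtain ⟨u₀⟩ : Nonempty ι := Fintype.card_pos_iff.mp (by rw [hcard]; positivity)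
  obtain ⟨c, hc, hac, hcC⟩ := hC ι (Fin m × Fin n)
    (fun k u ↦ lam u ^ (k.2 : ℕ) * χ u ^ (k.1 : ℕ)) (H ^ n * X ^ m)
    (fun h0 ↦ by simpa using congrFun₂ h0 (0, 0) u₀) (by simpa using hcard) (fun k u ↦ by
      push_cast
      refine (house_mul_le _ _).trans (mul_le_mul ?_ ?_ (house_nonneg _) (by positivity))
      · exact (house_pow_le _ _).trans ((pow_le_pow_left₀ (house_nonneg _) (hlam u) _).trans
          (pow_le_pow_right₀ hH k.2.2.le))
      · exact (house_pow_le _ _).trans ((pow_le_pow_left₀ (house_nonneg _) (hχ u) _).trans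
          (pow_le_pow_right₀ hX k.1.2.le)))
  refine ⟨c, hc, fun k hk s hs ↦ ?_, hcC⟩
  have := congrFun hac (⟨k, hk⟩, ⟨s, hs⟩)
  simp only [Matrix.mulVec, dotProduct, Pi.zero_apply] at this
  rw [← this]
  exact Finset.sum_congr rfl fun u _ ↦ mul_comm _ _

/-- For `c ≠ 0` and distinct `lam u`, there is a least `r` for which one of the sums
`∑ u, c u * (lam u ^ r * χ u ^ k)` with `k < m` is nonzero. -/
theorem exists_min_order {R ι : Type*} [CommRing R] [IsDomain R] [Fintype ι]
    {c lam χ : ι → R} (hc : c ≠ 0) (hlam : Function.Injective lam) {m : ℕ} (hm : 0 < m) :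
    ∃ r, ∃ k < m, ∑ u, c u * (lam u ^ r * χ u ^ k) ≠ 0 ∧
      ∀ j < m, ∀ i < r, ∑ u, c u * (lam u ^ i * χ u ^ j) = 0 := by
  classical
  have hex : ∃ r, ∃ k < m, ∑ u, c u * (lam u ^ r * χ u ^ k) ≠ 0 := by
    obtain ⟨s, hs⟩ := exists_sum_mul_pow_ne_zero hlam hc
    exact ⟨s, 0, hm, by simpa using hs⟩
  obtain ⟨k, hk, hne⟩ := Nat.find_spec hex
  refine ⟨Nat.find hex, k, hk, hne, fun j hj i hi ↦ ?_⟩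
  by_contra h
  exact Nat.find_min hex hi ⟨j, hj, h⟩

theorem one_le_of_exp_eq (σ : K →+* ℂ) {ι : Type*} [Fintype ι] {c lam χ : ι → 𝓞 K} {δ η : ℂ}
    (hδ : δ ≠ 0) (hη : η ≠ 0) (hexp : ∀ u, Complex.exp (δ * σ (lam u)) = σ (χ u) / η)
    {H X C R : ℝ} (hX : 1 ≤ X) (hc : ∀ u, house (c u : K) ≤ C)
    (hlam : ∀ u, house (lam u : K) ≤ H) (hχ : ∀ u, house (χ u : K) ≤ X) {m r k : ℕ} (hk : k < m)
    (hR : 2 * m ≤ R) (hne : ∑ u, c u * (lam u ^ r * χ u ^ k) ≠ 0)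
    (h0 : ∀ j < m, ∀ i < r, ∑ u, c u * (lam u ^ i * χ u ^ j) = 0) :
    1 ≤ ‖δ⁻¹‖ ^ r * ‖η‖ ^ k * (r.factorial *
        (Fintype.card ι * C * Real.exp (‖δ‖ * H * R) * (4 * m / R) ^ (m * r))) *
      (Fintype.card ι * C * (H ^ r * X ^ m)) ^ (Module.finrank ℚ K - 1) := by
  have hderiv (i j : ℕ) :
      iteratedDeriv i (fun z ↦ ∑ u, σ (c u) * Complex.exp (δ * σ (lam u) * z)) (j : ℂ) =
        δ ^ i / η ^ j * σ (∑ u, c u * (lam u ^ i * χ u ^ j) : 𝓞 K) := by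
    rw [iteratedDeriv_sum_const_mul_cexp]
    push_cast
    rw [map_sum, Finset.mul_sum]
    refine Finset.sum_congr rfl fun u _ ↦ ?_
    rw [mul_comm _ (j : ℂ), Complex.exp_nat_mul, hexp]
    simp only [map_mul, map_pow, mul_pow, div_pow]
    field_simp
  have hbound : ∀ z : ℂ, ‖z‖ = R → ‖∑ u, σ (c u) * Complex.exp (δ * σ (lam u) * z)‖ ≤
      Fintype.card ι * C * Real.exp (‖δ‖ * H * R) := by
    intro z hz
    refine (norm_sum_le _ _).trans ?_
    rw [mul_assoc, ← nsmul_eq_mul, ← Finset.card_univ]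
    refine Finset.sum_le_card_nsmul _ _ _ fun u _ ↦ ?_
    have hC := (house_nonneg (c u : K)).trans (hc u)
    rw [norm_mul]
    refine mul_le_mul ((norm_embedding_le_house _ σ).trans (hc u)) ?_ (norm_nonneg _) hC
    refine (Complex.norm_exp_le_exp_norm _).trans (Real.exp_le_exp.mpr ?_)
    rw [norm_mul, norm_mul, hz]
    have : 0 ≤ R := hz ▸ norm_nonneg z
    gcongr
    exact (norm_embedding_le_house _ σ).trans (hlam u)
  have hup := norm_iteratedDeriv_le_of_iteratedDeriv_natCast_eq_zero
    (f := fun z ↦ ∑ u, σ (c u) * Complex.exp (δ * σ (lam u) * z)) (by fun_prop) (r := r)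
    (fun j hj i hi ↦ by rw [hderiv, h0 j hj i hi]; simp) hR hbound hk
  rw [hderiv] at hup
  refine (one_le_norm_mul_house_pow hne σ).trans ?_
  have hhouse := house_sum_mul_pow_mul_pow_le hX hc hlam hχ r hk.le
  refine mul_le_mul ?_ (pow_le_pow_left₀ (house_nonneg _) hhouse _)
    (pow_nonneg (house_nonneg _) _) ?_
  · calc _ = ‖δ⁻¹‖ ^ r * ‖η‖ ^ k *
          ‖δ ^ r / η ^ k * σ (∑ u, c u * (lam u ^ r * χ u ^ k) : 𝓞 K)‖ := by
          rw [← norm_pow, ← norm_pow, ← norm_mul, ← norm_mul]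
          rw [inv_pow]
          congr 1
          field_simp
      _ ≤ _ := by gcongr
  · exact mul_nonneg (by positivity) ((norm_nonneg _).trans hup)

end NumberField

/-- The numerical contradiction behind the Gelfond–Schneider theorem: the parameter `r` is bounded
in terms of `h` and `e` alone. -/
theorem le_of_one_le_gelfond_estimate {h : ℝ} (hh : 1 ≤ h) {e M m n L r k : ℕ}
    (hM : M = 2 * e + 3) (hm : m = 2 * M) (hL : 0 < L) (hLn : L ≤ n) (hnr : n ≤ r)
    (hLL : L * L = 2 * (m * n)) (hk : k ≤ m) {C : ℝ}
    (hC : C = h * (h * ((L * L : ℕ) : ℝ) * ((2 * h * L) ^ n * (h ^ (2 * L)) ^ m)))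
    (hone : 1 ≤ h ^ r * (h ^ (2 * L)) ^ k * (r.factorial * (((L * L : ℕ) : ℝ) * C *
        Real.exp (h * (2 * h * L) * (r / L)) * (4 * m / (r / L)) ^ (m * r))) *
      (((L * L : ℕ) : ℝ) * C * ((2 * h * L) ^ r * (h ^ (2 * L)) ^ m)) ^ e) :
    (r : ℝ) ≤ h * h ^ (2 * m) * (4 * (h ^ 2 * 4 * (2 * h) * h ^ (2 * m)) *
      Real.exp (2 * h ^ 2) * (32 * m ^ 3) ^ M) *
      (4 * (h ^ 2 * 4 * (2 * h) * h ^ (2 * m)) * (2 * h) * h ^ (2 * m)) ^ e := by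
  have hr : 0 < r := by lia
  have hr' : (0 : ℝ) < r := by exact_mod_cast hr
  have hL' : (0 : ℝ) < L := by exact_mod_cast hL
  have hLr : (L : ℝ) ≤ r := by exact_mod_cast hLn.trans hnr
  have hh0 : 0 < h := by linarith
  have hcard : ((L * L : ℕ) : ℝ) ≤ 4 ^ r := by
    have : L ≤ 2 ^ r := (hLn.trans hnr).trans Nat.lt_two_pow_self.le
    have h4 : (4 : ℕ) ^ r = 2 ^ r * 2 ^ r := by rw [← mul_pow]; norm_num
    exact_mod_cast h4 ▸ Nat.mul_le_mul this this
  have hX (j : ℕ) (hj : j ≤ m) : (h ^ (2 * L)) ^ j ≤ (h ^ (2 * m)) ^ r := by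
    rw [← pow_mul, ← pow_mul]
    refine pow_le_pow_right₀ hh ?_
    have := Nat.mul_le_mul (hLn.trans hnr) hj
    nlinarith
  have hH (j : ℕ) (hj : j ≤ r) : (2 * h * L) ^ j ≤ (2 * h * r) ^ r := by
    have : 1 ≤ (2 * h * r) := by
      have : (1 : ℝ) ≤ r := by exact_mod_cast hr
      nlinarith
    exact (pow_le_pow_left₀ (by positivity) (by gcongr) j).trans (pow_le_pow_right₀ this hj)
  have hCr : C ≤ (h ^ 2 * 4 * (2 * h * r) * h ^ (2 * m)) ^ r := by
    rw [hC]
    calc _ = h ^ 2 * ((L * L : ℕ) : ℝ) * (2 * h * L) ^ n * (h ^ (2 * L)) ^ m := by ring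
      _ ≤ (h ^ 2) ^ r * 4 ^ r * (2 * h * r) ^ r * (h ^ (2 * m)) ^ r := by
        gcongr
        · exact le_self_pow₀ (one_le_pow₀ hh) hr.ne'
        · exact hH n hnr
        · exact hX m le_rfl
      _ = _ := by simp only [mul_pow]
  have hC0 : 0 ≤ C := by rw [hC]; positivity
  have hexp : Real.exp (h * (2 * h * L) * (r / L)) = Real.exp (2 * h ^ 2) ^ r := by
    rw [← Real.exp_nat_mul]
    congr 1
    field_simp
  have hR : (4 * m / (r / L) : ℝ) ^ (m * r) ≤ ((32 * m ^ 3 / r) ^ M) ^ r := by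
    have h2 : (4 * m / (r / L) : ℝ) ^ 2 ≤ 32 * m ^ 3 / r := by
      have h3 : (L : ℝ) ^ 2 ≤ 2 * m * r := by
        have : (n : ℝ) ≤ r := by exact_mod_cast hnr
        calc (L : ℝ) ^ 2 = 2 * m * n := by
              rw [sq]
              exact_mod_cast hLL.trans (by ring)
          _ ≤ _ := by gcongr
      calc (4 * m / (r / L) : ℝ) ^ 2 = (16 * m ^ 2 * L ^ 2 / r ^ 2 : ℝ) := by
            field_simp
            ring
        _ ≤ (16 * m ^ 2 * (2 * m * r) / r ^ 2 : ℝ) := by gcongr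
        _ = 32 * m ^ 3 / r := by field_simp; ring
    rw [hm, mul_assoc, pow_mul, ← pow_mul _ M]
    rw [hm] at h2
    gcongr
  have hfact : (r.factorial : ℝ) ≤ (r : ℝ) ^ r := by exact_mod_cast Nat.factorial_le_pow r
  set Z := h * h ^ (2 * m) * (4 * (h ^ 2 * 4 * (2 * h) * h ^ (2 * m)) *
      Real.exp (2 * h ^ 2) * (32 * m ^ 3) ^ M) *
      (4 * (h ^ 2 * 4 * (2 * h) * h ^ (2 * m)) * (2 * h) * h ^ (2 * m)) ^ e with hZ
  have hfinal : 1 ≤ (Z / r) ^ r := by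
    refine hone.trans ?_
    calc _ ≤ h ^ r * (h ^ (2 * m)) ^ r * ((r : ℝ) ^ r * (4 ^ r *
            (h ^ 2 * 4 * (2 * h * r) * h ^ (2 * m)) ^ r * Real.exp (2 * h ^ 2) ^ r *
            ((32 * m ^ 3 / r) ^ M) ^ r)) *
          (4 ^ r * (h ^ 2 * 4 * (2 * h * r) * h ^ (2 * m)) ^ r *
            ((2 * h * r) ^ r * (h ^ (2 * m)) ^ r)) ^ e := by
          rw [hexp]
          gcongr
          · exact hX k hk
          · exact hX m le_rfl
      _ = (h * h ^ (2 * m) * (r * (4 * (h ^ 2 * 4 * (2 * h * r) * h ^ (2 * m)) *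
            Real.exp (2 * h ^ 2) * (32 * m ^ 3 / r) ^ M)) *
          (4 * (h ^ 2 * 4 * (2 * h * r) * h ^ (2 * m)) *
            ((2 * h * r) * h ^ (2 * m))) ^ e) ^ r := by
          simp only [mul_pow, ← pow_mul, mul_comm e r, mul_comm _ r, mul_assoc]
      _ = (Z / r) ^ r := by
          congr 1
          have : (r : ℝ) ^ M = r ^ 3 * (r ^ 2) ^ e := by rw [hM]; ring
          rw [hZ, div_pow, this,
            show 4 * (h ^ 2 * 4 * (2 * h * r) * h ^ (2 * m)) * ((2 * h * r) * h ^ (2 * m)) =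
              (4 * (h ^ 2 * 4 * (2 * h) * h ^ (2 * m)) * (2 * h) * h ^ (2 * m)) * (r : ℝ) ^ 2 by
              ring, mul_pow _ ((r : ℝ) ^ 2)]
          generalize (4 * (h ^ 2 * 4 * (2 * h) * h ^ (2 * m)) * (2 * h) * h ^ (2 * m)) ^ e = Y
          have hre : ((r : ℝ) ^ 2) ^ e ≠ 0 := by positivity
          generalize ((r : ℝ) ^ 2) ^ e = W at hre
          field_simp
  have hZ0 : 0 ≤ Z / r := by positivity
  rw [one_le_pow_iff_of_nonneg hZ0 hr.ne', le_div_iff₀ hr', one_mul] at hfinal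
  exact hfinal

namespace NumberField

variable {K : Type*} [Field K] [NumberField K]

theorem house_natCast_mul_add_le {D β : 𝓞 K} {h : ℝ} (hD : house (D : K) ≤ h)
    (hβ : house (β : K) ≤ h) {L a b : ℕ} (ha : a ≤ L) (hb : b ≤ L) :
    house ((a * D + b * β : 𝓞 K) : K) ≤ 2 * h * L := by
  have h0 := (house_nonneg (D : K)).trans hD
  push_cast
  calc _ ≤ (a : ℝ) * house (D : K) + b * house (β : K) :=
        (house_add_le _ _).trans_eq (by rw [house_nat_mul, house_nat_mul])
    _ ≤ L * h + L * h := by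
        gcongr <;> exact house_nonneg _
    _ = _ := by ring

theorem house_pow_mul_pow_le {D α γ : 𝓞 K} {h : ℝ} (hD : house (D : K) ≤ h)
    (hα : house (α : K) ≤ h) (hγ : house (γ : K) ≤ h) {L a b : ℕ} (ha : a ≤ L) (hb : b ≤ L) :
    house ((D ^ (L - a) * α ^ a * (D ^ (L - b) * γ ^ b) : 𝓞 K) : K) ≤ h ^ (2 * L) := by
  have h0 := (house_nonneg (D : K)).trans hD
  have hpow {x : K} (hx : house x ≤ h) (i : ℕ) : house (x ^ i) ≤ h ^ i :=
    (house_pow_le x i).trans (pow_le_pow_left₀ (house_nonneg _) hx i)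
  have hmul {x y : K} {i j : ℕ} (hx : house x ≤ h ^ i) (hy : house y ≤ h ^ j) :
      house (x * y) ≤ h ^ (i + j) :=
    (house_mul_le x y).trans (pow_add h i j ▸ mul_le_mul hx hy (house_nonneg _) (by positivity))
  push_cast
  convert! hmul (hmul (hpow hD (L - a)) (hpow hα a)) (hmul (hpow hD (L - b)) (hpow hγ b)) using 2
  lia

/-- The **Gelfond–Schneider theorem** for elements of a number field. -/
theorem exists_ratCast_eq_of_exp_eq (σ : K →+* ℂ) {α β γ : K} {l : ℂ} (hl : l ≠ 0)
    (hα : Complex.exp l = σ α) (hγ : Complex.exp (l * σ β) = σ γ) : ∃ q : ℚ, (q : K) = β := by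
  classical
  by_contra! hβ
  obtain ⟨D, hD⟩ := IsLocalization.exist_integer_multiples_of_finset
    (nonZeroDivisors (𝓞 K)) ({α, β, γ} : Finset K)
  obtain ⟨α', hα'⟩ := hD α (by simp)
  obtain ⟨β', hβ'⟩ := hD β (by simp)
  obtain ⟨γ', hγ'⟩ := hD γ (by simp)
  obtain ⟨D, hD0⟩ := D
  replace hD0 : (D : K) ≠ 0 := by simpa using nonZeroDivisors.ne_zero hD0
  simp only [Algebra.smul_def] at hα' hβ' hγ'
  have hσD : σ D ≠ 0 := (map_ne_zero σ).mpr hD0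
  set δ : ℂ := l / σ D with hδ
  have hδ0 : δ ≠ 0 := div_ne_zero hl hσD
  obtain ⟨C, hC⟩ := exists_siegel_const_sum_mul_pow_mul_pow K
  obtain ⟨h, hh1, hDh, hαh, hβh, hγh, hδh, hδh', hCh⟩ : ∃ h : ℝ, 1 ≤ h ∧ house (D : K) ≤ h ∧
      house (α' : K) ≤ h ∧ house (β' : K) ≤ h ∧ house (γ' : K) ≤ h ∧ ‖δ‖ ≤ h ∧ ‖δ⁻¹‖ ≤ h ∧
      |C| ≤ h := by
    have h₁ := house_nonneg (D : K)
    have h₂ := house_nonneg (α' : K)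
    have h₃ := house_nonneg (β' : K)
    have h₄ := house_nonneg (γ' : K)
    have h₅ := norm_nonneg δ
    have h₆ := norm_nonneg δ⁻¹
    have h₇ := abs_nonneg C
    refine ⟨1 + house (D : K) + house (α' : K) + house (β' : K) + house (γ' : K) + ‖δ‖ + ‖δ⁻¹‖ +
      |C|, ?_, ?_, ?_, ?_, ?_, ?_, ?_, ?_⟩ <;> linarith
  have hh0 : 0 < h := by linarith
  obtain ⟨e, he⟩ : ∃ e, e = Module.finrank ℚ K - 1 := ⟨_, rfl⟩
  obtain ⟨M, hM⟩ : ∃ M, M = 2 * e + 3 := ⟨_, rfl⟩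
  obtain ⟨m, hm⟩ : ∃ m, m = 2 * M := ⟨_, rfl⟩
  have hm0 : 0 < m := by lia
  obtain ⟨Z, hZ⟩ : ∃ Z, Z = h * h ^ (2 * m) * (4 * (h ^ 2 * 4 * (2 * h) * h ^ (2 * m)) *
      Real.exp (2 * h ^ 2) * (32 * m ^ 3) ^ M) *
      (4 * (h ^ 2 * 4 * (2 * h) * h ^ (2 * m)) * (2 * h) * h ^ (2 * m)) ^ e := ⟨_, rfl⟩
  obtain ⟨x, hxZ, hxm⟩ : ∃ x : ℕ, Z < x ∧ 2 * m ≤ x := by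
    obtain ⟨x, hx⟩ := exists_nat_gt Z
    exact ⟨max x (2 * m), hx.trans_le (by exact_mod_cast le_max_left _ _), le_max_right _ _⟩
  have hx0 : 0 < x := by lia
  obtain ⟨L, hL⟩ : ∃ L, L = 2 * m * x := ⟨_, rfl⟩
  have hL0 : 0 < L := by rw [hL]; positivity
  obtain ⟨n, hn⟩ : ∃ n, n = L * x := ⟨_, rfl⟩
  have hn0 : 0 < n := by rw [hn]; positivity
  have hLL : L * L = 2 * (m * n) := by rw [hn, hL]; ring
  have hLn : L ≤ n := hn ▸ Nat.le_mul_of_pos_right L hx0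
  let lam (u : Fin L × Fin L) : 𝓞 K := (u.1 : ℕ) * D + (u.2 : ℕ) * β'
  let χ (u : Fin L × Fin L) : 𝓞 K :=
    D ^ (L - u.1) * α' ^ (u.1 : ℕ) * (D ^ (L - u.2) * γ' ^ (u.2 : ℕ))
  have hlam_house (u) : house (lam u : K) ≤ 2 * h * L :=
    house_natCast_mul_add_le hDh hβh u.1.2.le u.2.2.le
  have hχ_house (u) : house (χ u : K) ≤ h ^ (2 * L) :=
    house_pow_mul_pow_le hDh hαh hγh u.1.2.le u.2.2.le
  have hlam : Function.Injective lam := by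
    rintro ⟨a, b⟩ ⟨a', b'⟩ hab
    have h1 : (D : K) * ((a : ℕ) + (b : ℕ) * β) = D * ((a' : ℕ) + (b' : ℕ) * β) := by
      have := congrArg (algebraMap (𝓞 K) K) hab
      simp only [lam, map_add, map_mul, map_natCast, hβ'] at this
      linear_combination this
    replace h1 := mul_left_cancel₀ hD0 h1
    by_cases hb : b = b'
    · subst hb
      have : ((a : ℕ) : K) = ((a' : ℕ) : K) := by linear_combination h1
      rw [Nat.cast_inj, Fin.val_inj] at this
      rw [this]
    · have hb' : ((b : ℕ) : K) - ((b' : ℕ) : K) ≠ 0 := by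
        rw [sub_ne_zero, Ne, Nat.cast_inj, Fin.val_inj]
        exact hb
      refine absurd ?_ (hβ (((a' : ℕ) - (a : ℕ)) / ((b : ℕ) - (b' : ℕ))))
      push_cast
      rw [div_eq_iff hb']
      linear_combination -h1
  have hexp (u) : Complex.exp (δ * σ (lam u)) = σ (χ u) / σ D ^ (2 * L) := by
    have harg : δ * σ (lam u) = (u.1 : ℕ) * l + (u.2 : ℕ) * (l * σ β) := by
      simp only [lam, map_add, map_mul, map_natCast, hβ', hδ]
      field_simp
    have hpow (a : ℕ) (ha : a ≤ L) : σ D ^ L = σ D ^ (L - a) * σ D ^ a := by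
      rw [← pow_add, Nat.sub_add_cancel ha]
    rw [harg, Complex.exp_add, Complex.exp_nat_mul, Complex.exp_nat_mul, hα, hγ, two_mul, pow_add,
      eq_div_iff (by positivity)]
    nth_rw 1 [hpow u.1 u.1.2.le]
    rw [hpow u.2 u.2.2.le]
    simp only [χ, map_mul, map_pow, hα', hγ', mul_pow]
    ring
  have h2hL : 1 ≤ 2 * h * L := by
    have : (1 : ℝ) ≤ L := by exact_mod_cast hL0
    nlinarith
  have hX1 : 1 ≤ h ^ (2 * L) := one_le_pow₀ hh1
  obtain ⟨c, hc0, hcvan, hcC⟩ := hC (Fin L × Fin L) lam χ m n (2 * h * L) (h ^ (2 * L)) hm0 hn0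
    h2hL hX1 (by simpa using hLL) hlam_house hχ_house
  obtain ⟨r, k, hk, hne, hvan⟩ := exists_min_order (χ := χ) hc0 hlam hm0
  have hnr : n ≤ r := by
    by_contra! hr
    exact hne (hcvan k hk r hr)
  have hcard : Fintype.card (Fin L × Fin L) = L * L := by simp
  rw [hcard] at hcC
  have hcC' (u) : house (c u : K) ≤
      h * (h * ((L * L : ℕ) : ℝ) * ((2 * h * L) ^ n * (h ^ (2 * L)) ^ m)) := by
    refine (hcC u).trans ?_
    rw [mul_assoc C, mul_assoc h, ← mul_assoc C, ← mul_assoc h]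
    gcongr ?_ * _
    nlinarith [abs_mul_abs_self C, abs_nonneg C]
  have hR : 2 * (m : ℝ) ≤ r / L := by
    rw [le_div_iff₀ (by positivity)]
    exact_mod_cast (Nat.mul_le_mul_right L hxm).trans ((mul_comm x L).le.trans (hn ▸ hnr))
  have hone := one_le_of_exp_eq σ hδ0 (pow_ne_zero (2 * L) hσD) hexp hX1 hcC' hlam_house hχ_house
    hk hR hne hvan
  rw [hcard, ← he] at hone
  have hbound := le_of_one_le_gelfond_estimate hh1 hM hm hL0 hLn hnr hLL hk.le rfl (hone.trans (by
    gcongr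
    rw [norm_pow]
    gcongr
    exact (norm_embedding_le_house _ σ).trans hDh))
  rw [← hZ] at hbound
  have hxr : (x : ℝ) ≤ r := by
    exact_mod_cast (Nat.le_mul_of_pos_left x hL0).trans (hn ▸ hnr)
  linarith

end NumberField

/-- The **Gelfond–Schneider theorem**: if `exp l` is algebraic for some `l ≠ 0` and `β` is algebraic
and irrational, then `exp (l * β)` is transcendental. -/
theorem Complex.transcendental_exp_mul {l β : ℂ} (hl : l ≠ 0) (hα : IsAlgebraic ℚ (exp l))
    (hβ : IsAlgebraic ℚ β) (hβ' : β ∉ Set.range ((↑) : ℚ → ℂ)) :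
    Transcendental ℚ (exp (l * β)) := by
  intro hγ
  let S : Set ℂ := {exp l, β, exp (l * β)}
  let K := IntermediateField.adjoin ℚ S
  have hS : ∀ x ∈ S, IsIntegral ℚ x := by
    rintro x (rfl | rfl | rfl)
    exacts [hα.isIntegral, hβ.isIntegral, hγ.isIntegral]
  have : FiniteDimensional ℚ K :=
    IntermediateField.finiteDimensional_adjoin hS
  have : NumberField K := ⟨⟩
  have hmem : ∀ x ∈ S, x ∈ K := fun x hx ↦ IntermediateField.subset_adjoin ℚ S hx
  obtain ⟨q, hq⟩ := NumberField.exists_ratCast_eq_of_exp_eq (algebraMap K ℂ)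
    (α := ⟨exp l, hmem _ (by simp [S])⟩) (β := ⟨β, hmem _ (by simp [S])⟩)
    (γ := ⟨exp (l * β), hmem _ (by simp [S])⟩) hl rfl rfl
  exact hβ' ⟨q, by simpa using congrArg (algebraMap K ℂ) hq⟩

/-- A rational point of the unit circle that is an algebraic integer lies on a coordinate axis. -/
theorem Rat.eq_zero_or_eq_zero_of_isIntegral {p q : ℚ} (hpq : p ^ 2 + q ^ 2 = 1)
    (h : IsIntegral ℤ ((p : ℂ) + q * Complex.I)) : p = 0 ∨ q = 0 := by
  have hconj : IsIntegral ℤ ((p : ℂ) - q * Complex.I) := by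
    simpa [sub_eq_add_neg] using h.map (Complex.conjAe.toAlgHom.restrictScalars ℤ)
  have hI : IsIntegral ℤ Complex.I := ⟨Polynomial.X ^ 2 + 1, by monicity!, by simp⟩
  have hint {x : ℚ} (hx : IsIntegral ℤ (x : ℂ)) : ∃ a : ℤ, (a : ℚ) = x :=
    IsIntegrallyClosed.isIntegral_iff.mp
      ((isIntegral_algHom_iff ((algebraMap ℚ ℂ).toIntAlgHom) (algebraMap ℚ ℂ).injective).mp hx)
  obtain ⟨a, ha⟩ := hint (x := 2 * p) (by
    have h2p : ((2 * p : ℚ) : ℂ) = (p + q * Complex.I) + (p - q * Complex.I) := by push_cast; ring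
    exact h2p ▸ h.add hconj)
  obtain ⟨b, hb⟩ := hint (x := 2 * q) (by
    have h2q : ((2 * q : ℚ) : ℂ) =
        ((p - q * Complex.I) - (p + q * Complex.I)) * Complex.I := by
      push_cast
      linear_combination (2 * q : ℂ) * Complex.I_sq
    exact h2q ▸ (hconj.sub h).mul hI)
  have hab : a ^ 2 + b ^ 2 = 4 := by
    have : (a : ℚ) ^ 2 + (b : ℚ) ^ 2 = 4 := by rw [ha, hb]; linear_combination 4 * hpq
    exact_mod_cast this
  have hab0 : a = 0 ∨ b = 0 := by
    have ha1 : a ≤ 2 := by nlinarith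
    have ha2 : -2 ≤ a := by nlinarith
    have hb1 : b ≤ 2 := by nlinarith
    have hb2 : -2 ≤ b := by nlinarith
    interval_cases a <;> interval_cases b <;> simp_all
  rcases hab0 with rfl | rfl
  · left; simpa using ha.symm
  · right; simpa using hb.symm

theorem arg_div_two_pi_transcendental
    (p q : ℚ) (hpq : p ^ 2 + q ^ 2 = 1) (hp : p ≠ 0) (hq : q ≠ 0) :
    Transcendental ℚ
      (Complex.arg ((p : ℂ) + (q : ℂ) * Complex.I) / (2 * Real.pi)) := by
  intro ht
  set w : ℂ := (p : ℂ) + q * Complex.I with hw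
  set t : ℝ := Complex.arg w / (2 * Real.pi) with ht_def
  have hwnorm : ‖w‖ = 1 := by
    have : Complex.normSq w = 1 := by
      rw [hw, ← Complex.ofReal_ratCast, ← Complex.ofReal_ratCast, Complex.normSq_add_mul_I]
      exact_mod_cast hpq
    rw [Complex.norm_def, this, Real.sqrt_one]
  have hexp : Complex.exp (2 * Real.pi * Complex.I * t) = w := by
    conv_rhs => rw [← Complex.norm_mul_exp_arg_mul_I w, hwnorm]
    rw [ht_def]
    push_cast
    rw [one_mul]
    congr 1
    field_simp [Real.pi_ne_zero]
  have hwalg : IsAlgebraic ℚ w :=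
    (isAlgebraic_algebraMap p).add ((isAlgebraic_algebraMap q).mul
      ⟨Polynomial.X ^ 2 + 1, (by monicity! : Polynomial.Monic _).ne_zero, by simp⟩)
  refine Complex.transcendental_exp_mul (l := 2 * Real.pi * Complex.I) (β := t)
    Complex.two_pi_I_ne_zero (by rw [Complex.exp_two_pi_mul_I]; exact isAlgebraic_one)
    ht.algebraMap ?_ (hexp ▸ hwalg)
  rintro ⟨x, hx⟩
  have hpow : w ^ x.den = 1 := by
    rw [← hexp, ← Complex.exp_nat_mul, Complex.exp_eq_one_iff]
    refine ⟨x.num, ?_⟩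
    have : (x.den : ℂ) * x = x.num := by exact_mod_cast Rat.den_mul_eq_num x
    rw [← hx]
    linear_combination (2 * Real.pi * Complex.I) * this
  have hint : IsIntegral ℤ w := IsIntegral.of_pow x.den_pos (hpow ▸ isIntegral_one)
  exact (Rat.eq_zero_or_eq_zero_of_isIntegral hpq hint).elim hp hq
end

section
/- Let θ ∈ (−π, π], let r > 0 be a real number, and define w_m = r·|sin(mθ)| − m·(1 − cos(mθ)) for m ∈ ℕ. Let ε ∈ (0,1) and δ > 0 be such that for all x ∈ [−δ, δ]: (1−ε)|x| ≤ |sin x| ≤ |x| and (1−ε)x²/2 ≤ 1 − cos x ≤ x²/2. Let N ∈ ℕ with N ≥ 1 be such that 2r/N ≤ δ and, for all x ∈ (−π, π], if 1 − cos x < 2r/N then |x| ≤ δ. Then for any m ≥ N: if w_m > 0, then m·[mθ]_{2π} < 2r/(1−ε). -/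
theorem dist2pi_le (x : ℝ) (j : ℤ) : dist2pi x ≤ |x - 2 * Real.pi * (j : ℝ)| :=
  csInf_le ⟨0, by rintro _ ⟨k, rfl⟩; exact abs_nonneg _⟩ ⟨j, rfl⟩

theorem exists_sub_two_pi_mul_int_mem_Ioc (x : ℝ) :
    ∃ j : ℤ, x - 2 * Real.pi * (j : ℝ) ∈ Set.Ioc (-Real.pi) Real.pi := by
  refine ⟨toIocDiv Real.two_pi_pos (-Real.pi) x, ?_⟩
  have h := sub_toIocDiv_zsmul_mem_Ioc Real.two_pi_pos (-Real.pi) x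
  rw [zsmul_eq_mul] at h
  constructor <;> linarith [h.1, h.2]

theorem claim_one
    (θ : ℝ) (hθ : θ ∈ Set.Ioc (-Real.pi) Real.pi) (r : ℝ) (hr : 0 < r)
    (w : ℕ → ℝ)
    (hw : ∀ m : ℕ, w m = r * |Real.sin ((m : ℝ) * θ)| -
      (m : ℝ) * (1 - Real.cos ((m : ℝ) * θ)))
    (ε : ℝ) (hε : ε ∈ Set.Ioo (0 : ℝ) 1) (δ : ℝ) (hδ : 0 < δ)
    (hsin : ∀ x ∈ Set.Icc (-δ) δ,
      (1 - ε) * |x| ≤ |Real.sin x| ∧ |Real.sin x| ≤ |x|)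
    (hcos : ∀ x ∈ Set.Icc (-δ) δ,
      (1 - ε) * x ^ 2 / 2 ≤ 1 - Real.cos x ∧ 1 - Real.cos x ≤ x ^ 2 / 2)
    (N : ℕ) (hN : 1 ≤ N) (hNδ : 2 * r / (N : ℝ) ≤ δ)
    (hNcos : ∀ x ∈ Set.Ioc (-Real.pi) Real.pi,
      1 - Real.cos x < 2 * r / (N : ℝ) → |x| ≤ δ)
    (m : ℕ) (hm : N ≤ m) (hwm : 0 < w m) :
    (m : ℝ) * dist2pi ((m : ℝ) * θ) < 2 * r / (1 - ε) := by
  obtain ⟨j, hj⟩ := exists_sub_two_pi_mul_int_mem_Ioc ((m : ℝ) * θ)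
  have hdist := dist2pi_le ((m : ℝ) * θ) j
  rw [hw] at hwm
  set y := (m : ℝ) * θ - 2 * Real.pi * (j : ℝ) with hy
  have hmy : (m : ℝ) * θ = y + j * (2 * Real.pi) := by rw [hy]; ring
  rw [hmy, Real.sin_add_int_mul_two_pi, Real.cos_add_int_mul_two_pi] at hwm
  have hN0 : (0 : ℝ) < N := by exact_mod_cast hN
  have hmN : (N : ℝ) ≤ m := by exact_mod_cast hm
  have hm0 : (0 : ℝ) < m := hN0.trans_le hmN
  have hε0 : 0 < 1 - ε := sub_pos.mpr hε.2
  have hyδ : |y| ≤ δ := by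
    refine hNcos y hj ?_
    rw [lt_div_iff₀ hN0]
    have h1 : r * |Real.sin y| ≤ r * 1 :=
      mul_le_mul_of_nonneg_left (Real.abs_sin_le_one y) hr.le
    have h2 : (1 - Real.cos y) * N ≤ (1 - Real.cos y) * m :=
      mul_le_mul_of_nonneg_left hmN (sub_nonneg.mpr (Real.cos_le_one y))
    linarith
  have hymem : y ∈ Set.Icc (-δ) δ := abs_le.mp hyδ
  have hquad : (m : ℝ) * ((1 - ε) * y ^ 2 / 2) < r * |y| := by
    have h1 := mul_le_mul_of_nonneg_left (hsin y hymem).2 hr.le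
    have h2 := mul_le_mul_of_nonneg_left (hcos y hymem).1 hm0.le
    linarith
  have hylin : (m : ℝ) * |y| * (1 - ε) < 2 * r := by
    rw [← sq_abs] at hquad
    refine lt_of_mul_lt_mul_right ?_ (abs_nonneg y)
    linarith
  calc (m : ℝ) * dist2pi ((m : ℝ) * θ) ≤ m * |y| := mul_le_mul_of_nonneg_left hdist hm0.le
    _ < 2 * r / (1 - ε) := (lt_div_iff₀ hε0).mpr hylin
end

section
/- Let θ ∈ (−π, π] be such that θ/(2π) is irrational, let r > 0 be a real number, and define w_m = r·|sin(mθ)| − m·(1 − cos(mθ)) for m ∈ ℕ. Let ε ∈ (0,1) and δ > 0 be such that for all x ∈ [−δ, δ]: (1−ε)|x| ≤ |sin x| ≤ |x| and (1−ε)x²/2 ≤ 1 − cos x ≤ x²/2. Let N ∈ ℕ with N ≥ 1 be such that 2r/N ≤ δ and, for all x ∈ (−π, π], if 1 − cos x < 2r/N then |x| ≤ δ. Then for any m ≥ N: if m·[mθ]_{2π} < 2r·(1−ε), then w_m > 0. -/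
theorem exists_abs_sub_lt_of_dist2pi_lt {x c : ℝ} (h : dist2pi x < c) :
    ∃ j : ℤ, |x - 2 * Real.pi * (j : ℝ)| < c := by
  have hne : {y : ℝ | ∃ j : ℤ, y = |x - 2 * Real.pi * (j : ℝ)|}.Nonempty := ⟨_, 0, rfl⟩
  obtain ⟨_, ⟨j, rfl⟩, hj⟩ := exists_lt_of_csInf_lt hne h
  exact ⟨j, hj⟩

theorem natCast_mul_sub_two_pi_mul_ne_zero {θ : ℝ} (hirr : Irrational (θ / (2 * Real.pi)))
    {m : ℕ} (hm : m ≠ 0) (j : ℤ) : (m : ℝ) * θ - 2 * Real.pi * (j : ℝ) ≠ 0 := by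
  intro h
  apply (hirr.natCast_mul hm).ne_int j
  have := Real.pi_ne_zero
  field_simp
  linarith

theorem claim_two
    (θ : ℝ) (hθ : θ ∈ Set.Ioc (-Real.pi) Real.pi)
    (hirr : Irrational (θ / (2 * Real.pi))) (r : ℝ) (hr : 0 < r)
    (w : ℕ → ℝ)
    (hw : ∀ m : ℕ, w m = r * |Real.sin ((m : ℝ) * θ)| -
      (m : ℝ) * (1 - Real.cos ((m : ℝ) * θ)))
    (ε : ℝ) (hε : ε ∈ Set.Ioo (0 : ℝ) 1) (δ : ℝ) (hδ : 0 < δ)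
    (hsin : ∀ x ∈ Set.Icc (-δ) δ,
      (1 - ε) * |x| ≤ |Real.sin x| ∧ |Real.sin x| ≤ |x|)
    (hcos : ∀ x ∈ Set.Icc (-δ) δ,
      (1 - ε) * x ^ 2 / 2 ≤ 1 - Real.cos x ∧ 1 - Real.cos x ≤ x ^ 2 / 2)
    (N : ℕ) (hN : 1 ≤ N) (hNδ : 2 * r / (N : ℝ) ≤ δ)
    (hNcos : ∀ x ∈ Set.Ioc (-Real.pi) Real.pi,
      1 - Real.cos x < 2 * r / (N : ℝ) → |x| ≤ δ)
    (m : ℕ) (hm : N ≤ m)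
    (hlt : (m : ℝ) * dist2pi ((m : ℝ) * θ) < 2 * r * (1 - ε)) :
    0 < w m := by
  have hNpos : (0 : ℝ) < N := by exact_mod_cast hN
  have hNm : (N : ℝ) ≤ m := by exact_mod_cast hm
  have hmpos : (0 : ℝ) < m := hNpos.trans_le hNm
  obtain ⟨hε0, hε1⟩ := hε
  obtain ⟨j, hj⟩ := exists_abs_sub_lt_of_dist2pi_lt ((lt_div_iff₀' hmpos).2 hlt)
  have hx0 := natCast_mul_sub_two_pi_mul_ne_zero hirr (by omega : m ≠ 0) j
  have hper : (m : ℝ) * θ - 2 * Real.pi * (j : ℝ) = m * θ - j * (2 * Real.pi) := by ring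
  have hs := Real.sin_sub_int_mul_two_pi (m * θ) j
  have hc := Real.cos_sub_int_mul_two_pi (m * θ) j
  rw [← hper] at hs hc
  rw [hw, ← hs, ← hc]
  generalize (m : ℝ) * θ - 2 * Real.pi * (j : ℝ) = x at hj hx0 ⊢
  have hxδ : |x| ≤ δ := by
    refine hj.le.trans (le_trans ?_ hNδ)
    have : 2 * r * (1 - ε) ≤ 2 * r := by nlinarith
    gcongr
  have hsin_ge := (hsin x (abs_le.1 hxδ)).1
  have hcos_le := (hcos x (abs_le.1 hxδ)).2
  rw [lt_div_iff₀' hmpos] at hj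
  calc 0 < |x| * (2 * r * (1 - ε) - m * |x|) / 2 := by
        have := mul_pos (abs_pos.2 hx0) (sub_pos.2 hj)
        positivity
    _ = r * ((1 - ε) * |x|) - m * (x ^ 2 / 2) := by rw [← sq_abs x]; ring
    _ ≤ r * |Real.sin x| - m * (1 - Real.cos x) := by gcongr
end

section
/- Let R be a commutative ring, and let u, v : ℕ → R be sequences such that u satisfies a linear recurrence of order k over R (there exist a₁, …, a_k ∈ R with u_{n+k} = a₁u_{n+k−1} + … + a_k u_n for all n ≥ 0) and v satisfies a linear recurrence of order l over R. Then the pointwise product sequence (u_n·v_n)_{n≥0} satisfies a linear recurrence of order at most k·l over R (when R is a field; over a field, there exist m ≤ k·l and b₁, …, b_m in the field with u_{n+m}v_{n+m} = b₁u_{n+m−1}v_{n+m−1} + … + b_m u_n v_n for all n ≥ 0). -/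
open Matrix in
/-- By Cayley-Hamilton, the orbit of a vector under a square matrix satisfies the linear recurrence
given by the characteristic polynomial. -/
theorem apply_add_card_eq_neg_sum_charpoly_coeff {R ι : Type*} [CommRing R] [Nontrivial R]
    [Fintype ι] [DecidableEq ι] (M : Matrix ι ι R) (w : ℕ → ι → R)
    (hw : ∀ n, w (n + 1) = M *ᵥ w n) (n : ℕ) (i : ι) :
    w (n + Fintype.card ι) i =
      ∑ j ∈ Finset.range (Fintype.card ι), -M.charpoly.coeff j * w (n + j) i := by
  have hpow (j : ℕ) : w (n + j) = (M ^ j) *ᵥ w n := by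
    induction j with
    | zero => simp
    | succ j ih => rw [← add_assoc, hw, ih, pow_succ', mulVec_mulVec]
  have hlead : M.charpoly.coeff (Fintype.card ι) = 1 := by
    rw [← M.charpoly_natDegree_eq_dim]
    exact M.charpoly_monic.coeff_natDegree
  have h := congrArg (fun N => (N *ᵥ w n) i) M.aeval_self_charpoly
  simp only [Polynomial.aeval_eq_sum_range, M.charpoly_natDegree_eq_dim, Finset.sum_range_succ,
    hlead, one_smul, add_mulVec, sum_mulVec, smul_mulVec, ← hpow, Finset.sum_apply, Pi.add_apply,
    Pi.smul_apply, smul_eq_mul, zero_mulVec, Pi.zero_apply] at h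
  simp only [neg_mul, Finset.sum_neg_distrib]
  linear_combination h

/-- The windows of length `k` of a linear recurrence of order `k` are the orbit of a vector under a
square matrix. -/
theorem exists_matrix_of_linear_recurrence {R : Type*} [CommRing R] {k : ℕ} {u : ℕ → R}
    {a : Fin k → R}
    (hu : ∀ n : ℕ, u (n + k) = ∑ i : Fin k, a i * u (n + k - 1 - (i : ℕ))) :
    ∃ A : Matrix (Fin k) (Fin k) R,
      ∀ (n : ℕ) (i : Fin k), u (n + 1 + i) = ∑ j, A i j * u (n + j) := by
  have hrow (i : Fin k) : ∃ r : Fin k → R, ∀ n, u (n + 1 + i) = ∑ j, r j * u (n + j) := by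
    by_cases hi : (i : ℕ) + 1 < k
    · refine ⟨Pi.single ⟨i + 1, hi⟩ 1, fun n => ?_⟩
      simp [Pi.single_apply, add_comm, add_left_comm]
    · refine ⟨a ∘ Fin.rev, fun n => ?_⟩
      rw [show n + 1 + (i : ℕ) = n + k by omega, hu, ← Equiv.sum_comp Fin.revPerm]
      refine Finset.sum_congr rfl fun j _ => ?_
      simp only [Fin.revPerm_apply, Function.comp_apply, Fin.val_rev]
      congr 2
      omega
  choose A hA using hrow
  exact ⟨A, fun n i => hA i n⟩

open Matrix Kronecker in
theorem product_of_linear_recurrences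
    {F : Type*} [Field F] (u v : ℕ → F) (k l : ℕ)
    (a : Fin k → F)
    (hu : ∀ n : ℕ, u (n + k) = ∑ i : Fin k, a i * u (n + k - 1 - (i : ℕ)))
    (b : Fin l → F)
    (hv : ∀ n : ℕ, v (n + l) = ∑ i : Fin l, b i * v (n + l - 1 - (i : ℕ))) :
    ∃ m : ℕ, m ≤ k * l ∧ ∃ c : Fin m → F,
      ∀ n : ℕ, u (n + m) * v (n + m) =
        ∑ i : Fin m, c i * (u (n + m - 1 - (i : ℕ)) * v (n + m - 1 - (i : ℕ))) := by
  rcases Nat.eq_zero_or_pos k with rfl | hk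
  · exact ⟨0, Nat.zero_le _, 0, fun n => by simpa using Or.inl (hu n)⟩
  rcases Nat.eq_zero_or_pos l with rfl | hl
  · exact ⟨0, Nat.zero_le _, 0, fun n => by simpa using Or.inr (hv n)⟩
  obtain ⟨A, hA⟩ := exists_matrix_of_linear_recurrence hu
  obtain ⟨B, hB⟩ := exists_matrix_of_linear_recurrence hv
  have hrec (n : ℕ) := apply_add_card_eq_neg_sum_charpoly_coeff (A ⊗ₖ B)
    (fun n p => u (n + p.1) * v (n + p.2)) (fun n => by
      ext p
      simp only [hA, hB, mulVec, dotProduct, kroneckerMap_apply, Fintype.sum_prod_type,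
        Finset.sum_mul_sum, mul_mul_mul_comm]) n (⟨0, hk⟩, ⟨0, hl⟩)
  simp only [Fintype.card_prod, Fintype.card_fin, add_zero] at hrec
  refine ⟨k * l, le_rfl, fun i => -(A ⊗ₖ B).charpoly.coeff (k * l - 1 - i), fun n => ?_⟩
  rw [hrec, ← Finset.sum_range_reflect, Finset.sum_range]
  refine Finset.sum_congr rfl fun i _ => ?_
  rw [show n + k * l - 1 - (i : ℕ) = n + (k * l - 1 - i) by omega]
end
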